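/- arXiv:1304.5150 — 2 statements merged into one kernel-verified Lean document; each statement's English description precedes it below -/
import Mathlib

section
/- Fix c with 0 < c < 1, let ε_bsc ∈ (0,1/2) solve 1 - h₂(ε_bsc) = c, and fix z ∈ (0,1). Let μ = γ·δ_{x̌} + (1-γ)·δ_{x̂} with γ ∈ (0,1), 0 < x̌ ≤ z, and max(z, 1-2ε_bsc) ≤ x̂ < 1, satisfying the entropy constraint γ·h(x̌) + (1-γ)·h(x̂) = 1 - c. Then μ does not achieve the minimum of Λ_·(z) over BMS(c): there exists ν ∈ BMS(c) with Λ_ν(z) < Λ_μ(z). Consequently, any two-mass minimizer must satisfy x̌ = 0 or x̂ = 1 (or both). -/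
open MeasureTheory Real Set

/-- Binary entropy function (Lean's `logb` satisfies `logb 2 0 = 0`,
so the convention `0·log₂ 0 = 0` is automatic). -/
noncomputable def h2 (p : ℝ) : ℝ := -p * Real.logb 2 p - (1 - p) * Real.logb 2 (1 - p)

/-- `h(x) = h₂((1-x)/2)`. -/
noncomputable def hD (x : ℝ) : ℝ := h2 ((1 - x) / 2)

/-- `Λ_μ(z) = ∫ (1 - max(z,x)) dμ(x)`. -/
noncomputable def Lam (μ : Measure ℝ) (z : ℝ) : ℝ := ∫ x, (1 - max z x) ∂μ

theorem h2_eq_binEntropy_div (p : ℝ) : h2 p = Real.binEntropy p / Real.log 2 := by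
  simp only [h2, Real.binEntropy, Real.logb, Real.log_inv]
  ring

theorem hD_zero : hD 0 = 1 := by
  have h : (0 : ℝ) < Real.log 2 := Real.log_pos one_lt_two
  have h' : ((1 - 0) / 2 : ℝ) = 2⁻¹ := by norm_num
  rw [hD, h2_eq_binEntropy_div, h', Real.binEntropy_two_inv, div_self h.ne']

theorem hD_one : hD 1 = 0 := by
  simp [hD, h2]

theorem hD_strictAntiOn : StrictAntiOn hD (Set.Icc 0 1) := by
  rintro x ⟨hx0, hx1⟩ y ⟨hy0, hy1⟩ hxy
  have h : (0 : ℝ) < Real.log 2 := Real.log_pos one_lt_two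
  simp only [hD, h2_eq_binEntropy_div]
  refine div_lt_div_of_pos_right (Real.binEntropy_strictMonoOn ?_ ?_ ?_) h
  · constructor <;> linarith
  · constructor <;> linarith
  · linarith

theorem integral_two_dirac (f : ℝ → ℝ) {γ : ℝ} (hγ0 : 0 ≤ γ) (hγ1 : γ ≤ 1) (x y : ℝ) :
    ∫ t, f t ∂(ENNReal.ofReal γ • Measure.dirac x + ENNReal.ofReal (1 - γ) • Measure.dirac y) =
      γ * f x + (1 - γ) * f y := by
  have hf (a : ℝ) : Integrable f (Measure.dirac a) := integrable_dirac (by simp)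
  rw [integral_add_measure ((hf x).smul_measure ENNReal.ofReal_ne_top)
    ((hf y).smul_measure ENNReal.ofReal_ne_top), integral_smul_measure, integral_smul_measure,
    integral_dirac, integral_dirac, ENNReal.toReal_ofReal hγ0,
    ENNReal.toReal_ofReal (sub_nonneg.2 hγ1), smul_eq_mul, smul_eq_mul]

theorem Lam_two_dirac {γ : ℝ} (hγ0 : 0 ≤ γ) (hγ1 : γ ≤ 1) (x y z : ℝ) :
    Lam (ENNReal.ofReal γ • Measure.dirac x + ENNReal.ofReal (1 - γ) • Measure.dirac y) z =
      γ * (1 - max z x) + (1 - γ) * (1 - max z y) :=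
  integral_two_dirac (fun t => 1 - max z t) hγ0 hγ1 x y

theorem isProbabilityMeasure_two_dirac {γ : ℝ} (hγ0 : 0 ≤ γ) (hγ1 : γ ≤ 1) (x y : ℝ) :
    IsProbabilityMeasure
      (ENNReal.ofReal γ • Measure.dirac x + ENNReal.ofReal (1 - γ) • Measure.dirac y) := by
  constructor
  simp [← ENNReal.ofReal_add hγ0 (sub_nonneg.2 hγ1)]

/-- Splitting mass between `0` and a point `y ∈ [z, 1]` so as to meet the entropy constraint. -/
theorem exists_lam_lt_of_mass_at_zero {c z y γ L : ℝ} (hz0 : 0 ≤ z) (hzy : z ≤ y) (hy1 : y ≤ 1)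
    (hγ0 : 0 ≤ γ) (hγ1 : γ ≤ 1) (hcap : γ + (1 - γ) * hD y = 1 - c)
    (hL : γ * (1 - z) + (1 - γ) * (1 - y) < L) :
    ∃ ν : Measure ℝ, IsProbabilityMeasure ν ∧ ν (Set.Icc (0:ℝ) 1)ᶜ = 0 ∧
      (∫ x, hD x ∂ν) = 1 - c ∧ Lam ν z < L := by
  refine ⟨_, isProbabilityMeasure_two_dirac hγ0 hγ1 0 y, ?_, ?_, ?_⟩
  · simp [Measure.dirac_apply' _ measurableSet_Icc.compl, hz0.trans hzy, hy1]
  · rw [integral_two_dirac _ hγ0 hγ1, hD_zero, mul_one, hcap]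
  · rwa [Lam_two_dirac hγ0 hγ1, max_eq_left hz0, max_eq_right hzy]

/-- A two-mass member `γ·δ_{x̌} + (1-γ)·δ_{x̂}` of `BMS(c)` with `0 < x̌ ≤ z`
and `max(z, 1-2ε_bsc) ≤ x̂ < 1` does not achieve the minimum of `Λ_·(z)`;
hence a two-mass minimizer must have `x̌ = 0` or `x̂ = 1`. -/
theorem interior_two_masses_not_minimal
    (c ε : ℝ) (hc0 : 0 < c) (hc1 : c < 1)
    (hε0 : 0 < ε) (hε1 : ε < 1 / 2) (hεc : 1 - h2 ε = c)
    (z : ℝ) (hz0 : 0 < z) (hz1 : z < 1)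
    (γ xck xht : ℝ) (hγ0 : 0 < γ) (hγ1 : γ < 1)
    (hxck0 : 0 < xck) (hxckz : xck ≤ z)
    (hxht_lb : max z (1 - 2 * ε) ≤ xht) (hxht1 : xht < 1)
    (hcap : γ * hD xck + (1 - γ) * hD xht = 1 - c) :
    ∃ ν : Measure ℝ, IsProbabilityMeasure ν ∧ ν (Set.Icc (0:ℝ) 1)ᶜ = 0 ∧
      (∫ x, hD x ∂ν) = 1 - c ∧
      Lam ν z <
        Lam (ENNReal.ofReal γ • Measure.dirac xck +
          ENNReal.ofReal (1 - γ) • Measure.dirac xht) z := by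
  have hzx : z ≤ xht := (le_max_left _ _).trans hxht_lb
  rw [Lam_two_dirac hγ0.le hγ1.le, max_eq_left hxckz, max_eq_right hzx]
  rcases hzx.eq_or_lt with rfl | hlt
  · refine exists_lam_lt_of_mass_at_zero (γ := 1 - c) hz0.le hz1.le le_rfl (by linarith)
      (by linarith) (by rw [hD_one]; ring) ?_
    nlinarith [mul_pos hc0 (sub_pos.2 hz1)]
  · have ha : hD xck < 1 := hD_zero ▸ hD_strictAntiOn (by simp) ⟨hxck0.le, by linarith⟩ hxck0
    have hab : hD xht < hD xck :=
      hD_strictAntiOn ⟨hxck0.le, by linarith⟩ ⟨by linarith, hxht1.le⟩ (by linarith)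
    have hb : 0 < 1 - hD xht := by linarith
    have hlt' : γ * (hD xck - hD xht) / (1 - hD xht) < γ := by
      rw [div_lt_iff₀ hb]
      exact mul_lt_mul_of_pos_left (by linarith) hγ0
    refine exists_lam_lt_of_mass_at_zero (γ := γ * (hD xck - hD xht) / (1 - hD xht))
      hz0.le hzx hxht1.le (div_nonneg (mul_nonneg hγ0.le (by linarith)) hb.le) (by linarith) ?_ ?_
    · rw [← hcap]
      field_simp
      ring
    · nlinarith [mul_pos (sub_pos.2 hlt') (sub_pos.2 hlt)]
end

section
/- Fix c with 0 < c < 1, let ε_bsc ∈ (0,1/2) solve 1 - h₂(ε_bsc) = c, and let z_bsc = log₂(4·ε_bsc·(1-ε_bsc)) / log₂(ε_bsc/(1-ε_bsc)). Then for every z ∈ [0, z_bsc), the infimum over μ ∈ BMS(c) of Λ_μ(z) equals 2ε_bsc, and it is attained by the Dirac measure δ_{1-2ε_bsc} (the binary symmetric channel of capacity c). -/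
open MeasureTheory Real Set

/-- Membership in the family `BMS(c)`. -/
def memBMS (c : ℝ) (μ : Measure ℝ) : Prop :=
  IsProbabilityMeasure μ ∧ μ (Set.Icc (0:ℝ) 1)ᶜ = 0 ∧ ∫ x, hD x ∂μ = 1 - c

/-- The scalar inequality behind Gibbs' inequality. -/
lemma mul_log_sub_mul_log_le {p q : ℝ} (hp : 0 ≤ p) (hq : 0 < q) :
    p * Real.log q - p * Real.log p ≤ q - p := by
  rcases hp.eq_or_lt with rfl | hp
  · simpa using hq.le
  · have h := Real.log_le_sub_one_of_pos (div_pos hq hp)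
    rw [Real.log_div hq.ne' hp.ne'] at h
    have h' := mul_le_mul_of_nonneg_left h hp.le
    have e : p * (q / p - 1) = q - p := by field_simp
    linarith

/-- Gibbs' inequality: entropy is at most cross-entropy. -/
lemma h2_le_cross_entropy {p q : ℝ} (hp0 : 0 ≤ p) (hp1 : p ≤ 1) (hq0 : 0 < q) (hq1 : q < 1) :
    h2 p ≤ -p * Real.logb 2 q - (1 - p) * Real.logb 2 (1 - q) := by
  have h1 := mul_log_sub_mul_log_le hp0 hq0
  have h3 := mul_log_sub_mul_log_le (sub_nonneg.2 hp1) (sub_pos.2 hq1)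
  have hl : 0 < Real.log 2 := Real.log_pos one_lt_two
  have key : -p * Real.log p - (1 - p) * Real.log (1 - p) ≤
      -p * Real.log q - (1 - p) * Real.log (1 - q) := by linarith
  have := div_le_div_of_nonneg_right key hl.le
  unfold h2 Real.logb
  calc _ = _ := by ring
    _ ≤ _ := this
    _ = _ := by ring

lemma h2_le_one {p : ℝ} (hp0 : 0 ≤ p) (hp1 : p ≤ 1) : h2 p ≤ 1 := by
  have h := h2_le_cross_entropy (q := 1 / 2) hp0 hp1 (by norm_num) (by norm_num)
  have e : Real.logb 2 (1 / 2) = -1 := by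
    rw [one_div, Real.logb_inv, Real.logb_self_eq_one one_lt_two]
  rw [show (1 : ℝ) - 1 / 2 = 1 / 2 by norm_num, e] at h
  linarith

lemma h2_nonneg {p : ℝ} (hp0 : 0 ≤ p) (hp1 : p ≤ 1) : 0 ≤ h2 p := by
  have h1 := mul_nonpos_of_nonneg_of_nonpos hp0 (Real.logb_nonpos one_lt_two hp0 hp1)
  have h3 := mul_nonpos_of_nonneg_of_nonpos (sub_nonneg.2 hp1)
    (Real.logb_nonpos one_lt_two (sub_nonneg.2 hp1) (by linarith))
  unfold h2
  linarith

lemma measurable_hD : Measurable hD := by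
  unfold hD h2 Real.logb
  fun_prop

lemma integrable_hD {μ : Measure ℝ} [IsFiniteMeasure μ] (hμ : ∀ᵐ x ∂μ, x ∈ Set.Icc (0 : ℝ) 1) :
    Integrable hD μ := by
  refine Integrable.of_bound measurable_hD.aestronglyMeasurable 1 ?_
  filter_upwards [hμ] with x hx
  have h0 : 0 ≤ (1 - x) / 2 := by linarith [hx.2]
  have h1 : (1 - x) / 2 ≤ 1 := by linarith [hx.1]
  rw [Real.norm_eq_abs, abs_le]
  unfold hD
  exact ⟨by linarith [h2_nonneg h0 h1], h2_le_one h0 h1⟩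

lemma integrable_one_sub_max {μ : Measure ℝ} [IsFiniteMeasure μ]
    (hμ : ∀ᵐ x ∂μ, x ∈ Set.Icc (0 : ℝ) 1) (z : ℝ) :
    Integrable (fun x => 1 - max z x) μ := by
  refine Integrable.of_bound (by fun_prop) (2 + |z|) ?_
  filter_upwards [hμ] with x hx
  rw [Real.norm_eq_abs, abs_le]
  have := hx.1
  have := hx.2
  have := abs_nonneg z
  have := le_abs_self z
  constructor
  · have : max z x ≤ 1 + |z| := max_le (by linarith) (by linarith)
    linarith
  · have : x ≤ max z x := le_max_right _ _
    linarith

lemma logb_two_sub_pos {ε : ℝ} (hε0 : 0 < ε) (hε1 : ε < 1 / 2) :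
    0 < Real.logb 2 (1 - ε) - Real.logb 2 ε :=
  sub_pos.2 (Real.logb_lt_logb one_lt_two hε0 (by linarith))

/-- The threshold `z_bsc` is the point where the tangent to the constraint at `1 - 2ε`
meets the value forced at `x = 0`. -/
lemma zbsc_eq {ε : ℝ} (hε0 : 0 < ε) (hε1 : ε < 1 / 2) :
    Real.logb 2 (4 * ε * (1 - ε)) / Real.logb 2 (ε / (1 - ε)) =
      1 - 2 * ε - 2 / (Real.logb 2 (1 - ε) - Real.logb 2 ε) * (1 - h2 ε) := by
  have hL := logb_two_sub_pos hε0 hε1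
  have hq : 0 < 1 - ε := by linarith
  have h4 : Real.logb 2 4 = 2 := by
    rw [show (4 : ℝ) = 2 ^ 2 by norm_num, Real.logb_pow, Real.logb_self_eq_one one_lt_two]
    norm_num
  rw [Real.logb_mul (by positivity) hq.ne', Real.logb_mul (by norm_num) hε0.ne',
    Real.logb_div hε0.ne' hq.ne', h4, ← neg_sub (Real.logb 2 (1 - ε)), div_neg]
  unfold h2
  field_simp
  ring

/-- The affine-in-`hD` lower bound on `1 - max z x`, tight at `x = 1 - 2ε`. -/
lemma le_one_sub_max {ε z x : ℝ} (hε0 : 0 < ε) (hε1 : ε < 1 / 2)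
    (hz : z ≤ Real.logb 2 (4 * ε * (1 - ε)) / Real.logb 2 (ε / (1 - ε)))
    (hx : x ∈ Set.Icc (0 : ℝ) 1) :
    2 * ε + 2 / (Real.logb 2 (1 - ε) - Real.logb 2 ε) * (hD x - h2 ε) ≤ 1 - max z x := by
  have hL := logb_two_sub_pos hε0 hε1
  rw [zbsc_eq hε0 hε1] at hz
  have h0 : 0 ≤ (1 - x) / 2 := by linarith [hx.2]
  have h1 : (1 - x) / 2 ≤ 1 := by linarith [hx.1]
  have hlam := (div_pos two_pos hL).le
  have hle1 := mul_le_mul_of_nonneg_left (h2_le_one h0 h1) hlam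
  have hg : hD x - h2 ε ≤ ((1 - x) / 2 - ε) * (Real.logb 2 (1 - ε) - Real.logb 2 ε) := by
    have hg := h2_le_cross_entropy h0 h1 hε0 (by linarith : ε < 1)
    unfold hD
    rw [h2.eq_def ε]
    linarith
  have htan := mul_le_mul_of_nonneg_left hg hlam
  have e : 2 / (Real.logb 2 (1 - ε) - Real.logb 2 ε) *
      (((1 - x) / 2 - ε) * (Real.logb 2 (1 - ε) - Real.logb 2 ε)) = 1 - x - 2 * ε := by
    field_simp
  rw [le_sub_comm]
  refine max_le ?_ (by linarith)
  unfold hD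
  linarith

/-- For `z ∈ [0, z_bsc)`, the minimum of `Λ_μ(z)` over `μ ∈ BMS(c)` equals
`2ε_bsc` and is attained by the BSC, i.e. by the Dirac measure `δ_{1-2ε_bsc}`. -/
theorem Lam_min_below_zbsc
    (c ε : ℝ) (hc0 : 0 < c) (hc1 : c < 1)
    (hε0 : 0 < ε) (hε1 : ε < 1 / 2) (hεc : 1 - h2 ε = c)
    (z : ℝ) (hz0 : 0 ≤ z)
    (hz1 : z < Real.logb 2 (4 * ε * (1 - ε)) / Real.logb 2 (ε / (1 - ε))) :
    IsLeast {r : ℝ | ∃ μ : Measure ℝ, memBMS c μ ∧ Lam μ z = r} (2 * ε) ∧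
      memBMS c (Measure.dirac (1 - 2 * ε)) ∧
      Lam (Measure.dirac (1 - 2 * ε)) z = 2 * ε := by
  have hL := logb_two_sub_pos hε0 hε1
  have hzx : z ≤ 1 - 2 * ε := by
    have := zbsc_eq hε0 hε1
    have := mul_pos (div_pos two_pos hL) (hεc.symm ▸ hc0)
    linarith
  have hmem : memBMS c (Measure.dirac (1 - 2 * ε)) := by
    refine ⟨inferInstance, ?_, ?_⟩
    · rw [Measure.dirac_apply' _ measurableSet_Icc.compl]
      refine Set.indicator_of_notMem ?_ _
      rw [Set.notMem_compl_iff]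
      constructor <;> linarith
    · rw [integral_dirac, hD, show (1 - (1 - 2 * ε)) / 2 = ε by ring]
      linarith
  have hval : Lam (Measure.dirac (1 - 2 * ε)) z = 2 * ε := by
    rw [Lam, integral_dirac, max_eq_right hzx]
    ring
  refine ⟨⟨⟨_, hmem, hval⟩, ?_⟩, hmem, hval⟩
  rintro r ⟨μ, ⟨hprob, hsupp, hint⟩, rfl⟩
  have hae : ∀ᵐ x ∂μ, x ∈ Set.Icc (0 : ℝ) 1 := hsupp
  have hI := integrable_hD hae
  have hI' : Integrable
      (fun x => 2 / (Real.logb 2 (1 - ε) - Real.logb 2 ε) * (hD x - h2 ε)) μ :=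
    (hI.sub (integrable_const (h2 ε))).const_mul _
  have hmono := integral_mono_ae ((integrable_const (2 * ε)).add hI')
    (integrable_one_sub_max hae z)
    (hae.mono fun x hx => le_one_sub_max hε0 hε1 hz1.le hx)
  have hlhs : ∫ x, (2 * ε + 2 / (Real.logb 2 (1 - ε) - Real.logb 2 ε) * (hD x - h2 ε)) ∂μ
      = 2 * ε := by
    rw [integral_add (integrable_const _) hI', integral_const, integral_const_mul,
      integral_sub hI (integrable_const _), hint, integral_const, probReal_univ, one_smul, one_smul]
    rw [show 1 - c - h2 ε = 0 by linarith, mul_zero, add_zero]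
  exact hlhs.symm.trans_le hmono
end
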